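/- Let G be a strongly connected, structurally balanced signed digraph with gauge transformation D such that every entry of D·A·D is nonnegative, and let L̂ = (W·L + Lᵀ·W)/2 be its mirror Laplacian with eigenvalues λ_1(L̂) ≤ λ_2(L̂) ≤ … ≤ λ_n(L̂) in increasing order (so that λ_1(L̂) = 0 < λ_2(L̂)). Let k₁ > 0, k₂ > 0 and let m, r, p, q be positive odd integers with m > r and q > p. Suppose x : [0,∞) → ℝⁿ is differentiable and satisfies, for all t ≥ 0 and all i, ẋ_i(t) = k₁·⟨−(L̂·x(t))_i⟩^{m/r} + k₂·⟨−(L̂·x(t))_i⟩^{p/q}, where for y ∈ ℝ and a ratio s of odd integers, ⟨y⟩^{s} := sgn(y)·|y|^{s}. Set T = (1/λ_2(L̂))·( n^{(m−r)/(2r)}·r/(k₁·(m−r)) + q/(k₂·(q−p)) ). Then x is constant on [T,∞) and there exists c ∈ ℝ such that x(t) = c·D·1_n for all t ≥ T, where 1_n is the all-ones vector in ℝⁿ (fixed-time bipartite consensus with setting time at most T). -/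

import Mathlib

open Matrix BigOperators Filter

/-- In-degree of node `i`: sum of absolute values of the `i`-th row of `A`. -/
noncomputable def inDeg {n : ℕ} (A : Matrix (Fin n) (Fin n) ℝ) (i : Fin n) : ℝ := ∑ j, |A i j|

/-- Laplacian `L = Δ − A` of the signed digraph with adjacency matrix `A`. -/
noncomputable def lapOf {n : ℕ} (A : Matrix (Fin n) (Fin n) ℝ) : Matrix (Fin n) (Fin n) ℝ :=
  Matrix.diagonal (inDeg A) - A

/-- Laplacian `L̄ = Δ − Ā` of the induced unsigned digraph. -/
noncomputable def lapBar {n : ℕ} (A : Matrix (Fin n) (Fin n) ℝ) : Matrix (Fin n) (Fin n) ℝ :=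
  Matrix.diagonal (inDeg A) - Matrix.of (fun i j => |A i j|)

/-- `det(L̄_ii)`: determinant of `L̄` with its `i`-th row and column removed. -/
noncomputable def minorDet {n : ℕ} (A : Matrix (Fin n) (Fin n) ℝ) (i : Fin n) : ℝ :=
  Matrix.det ((lapBar A).submatrix (fun k : {j : Fin n // j ≠ i} => (k : Fin n))
    (fun k : {j : Fin n // j ≠ i} => (k : Fin n)))

/-- `W = diag(det(L̄_11), …, det(L̄_nn))`. -/
noncomputable def Wmat {n : ℕ} (A : Matrix (Fin n) (Fin n) ℝ) : Matrix (Fin n) (Fin n) ℝ :=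
  Matrix.diagonal (minorDet A)

/-- Mirror adjacency matrix `Â = (W·A + Aᵀ·W)/2`. -/
noncomputable def mirrorAdj {n : ℕ} (A : Matrix (Fin n) (Fin n) ℝ) : Matrix (Fin n) (Fin n) ℝ :=
  (1/2 : ℝ) • (Wmat A * A + Aᵀ * Wmat A)

/-- Mirror Laplacian `L̂ = (W·L + Lᵀ·W)/2`. -/
noncomputable def mirrorLap {n : ℕ} (A : Matrix (Fin n) (Fin n) ℝ) : Matrix (Fin n) (Fin n) ℝ :=
  (1/2 : ℝ) • (Wmat A * lapOf A + (lapOf A)ᵀ * Wmat A)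

/-- `(j, i)` is a directed edge when `a_ij ≠ 0`; strong connectivity: a directed
path between every ordered pair of distinct nodes. -/
def StronglyConnected {n : ℕ} (A : Matrix (Fin n) (Fin n) ℝ) : Prop :=
  ∀ i j : Fin n, i ≠ j → Relation.TransGen (fun u v => A v u ≠ 0) i j

/-- `σ` is the diagonal of a gauge transformation: each entry is `±1`. -/
def IsGauge {n : ℕ} (σ : Fin n → ℝ) : Prop := ∀ i, σ i = 1 ∨ σ i = -1

/-- Structural balance: there is a gauge transformation `D = diag σ` with all entries
of `D·A·D` (entrywise `σ i * A i j * σ j`) nonnegative. -/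
def StructBalanced {n : ℕ} (A : Matrix (Fin n) (Fin n) ℝ) : Prop :=
  ∃ σ : Fin n → ℝ, IsGauge σ ∧ ∀ i j, 0 ≤ σ i * A i j * σ j

/-- Improved Laplacian potential function
`Φ_e(x) = Σ_i Σ_j det(L̄_ii)·|a_ij|·(x_i − sgn(a_ij)·x_j)²`. -/
noncomputable def PhiE {n : ℕ} (A : Matrix (Fin n) (Fin n) ℝ) (x : Fin n → ℝ) : ℝ :=
  ∑ i, ∑ j, minorDet A i * |A i j| * (x i - Real.sign (A i j) * x j) ^ 2

theorem lapBar_mulVec_apply {n : ℕ} (A : Matrix (Fin n) (Fin n) ℝ) (v : Fin n → ℝ) (k : Fin n) :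
    (lapBar A *ᵥ v) k = ∑ l, |A k l| * (v k - v l) := by
  rw [lapBar, sub_mulVec, Pi.sub_apply, mulVec_diagonal]
  simp [inDeg, mulVec, dotProduct, mul_sub, Finset.sum_sub_distrib, Finset.sum_mul]

/-- Maximum principle for the Laplacian of a strongly connected digraph. -/
theorem StronglyConnected.le_of_lapBar_mulVec_nonpos {n : ℕ} {A : Matrix (Fin n) (Fin n) ℝ}
    (hsc : StronglyConnected A) (j : Fin n) (v : Fin n → ℝ)
    (hv : ∀ k, k ≠ j → v j ≤ v k → (lapBar A *ᵥ v) k ≤ 0) (k : Fin n) : v k ≤ v j := by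
  have : Nonempty (Fin n) := ⟨j⟩
  obtain ⟨K, hK⟩ := Finite.exists_max v
  by_cases hKj : K = j
  · exact hKj ▸ hK k
  have key : ∀ a b, A b a ≠ 0 → v b = v K → v j = v K ∨ v a = v K := by
    intro a b hab hb
    by_cases hbj : b = j
    · exact Or.inl (hbj ▸ hb)
    right
    have h1 := hv b hbj (hb ▸ hK j)
    rw [lapBar_mulVec_apply] at h1
    have h2 : ∀ l ∈ Finset.univ, 0 ≤ |A b l| * (v b - v l) := fun l _ =>
      mul_nonneg (abs_nonneg _) (sub_nonneg.2 (hb ▸ hK l))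
    have h3 := (Finset.sum_eq_zero_iff_of_nonneg h2).1
      (le_antisymm h1 (Finset.sum_nonneg h2)) a (Finset.mem_univ a)
    rcases mul_eq_zero.1 h3 with h | h
    · exact absurd (abs_eq_zero.1 h) hab
    · linarith
  have hreach : ∀ a, Relation.TransGen (fun u v => A v u ≠ 0) a K → v j = v K ∨ v a = v K := by
    intro a ha
    induction ha using Relation.TransGen.head_induction_on with
    | single h => exact key _ _ h rfl
    | head h _ ih => exact ih.elim Or.inl (key _ _ h)
  exact (or_self_iff.1 (hreach j (hsc j K (Ne.symm hKj)))) ▸ hK k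

theorem StronglyConnected.eq_of_lapBar_mulVec_eq_zero {n : ℕ} {A : Matrix (Fin n) (Fin n) ℝ}
    (hsc : StronglyConnected A) {v : Fin n → ℝ} (hv : lapBar A *ᵥ v = 0) (i j : Fin n) :
    v i = v j :=
  le_antisymm
    (hsc.le_of_lapBar_mulVec_nonpos j v (fun k _ _ => (congrFun hv k).le) i)
    (hsc.le_of_lapBar_mulVec_nonpos i v (fun k _ _ => (congrFun hv k).le) j)

theorem lapBar_mulVec_one {n : ℕ} (A : Matrix (Fin n) (Fin n) ℝ) : lapBar A *ᵥ 1 = 0 := by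
  ext k
  simp [lapBar_mulVec_apply]

theorem det_lapBar {n : ℕ} (hn : n ≠ 0) (A : Matrix (Fin n) (Fin n) ℝ) : (lapBar A).det = 0 := by
  have : NeZero n := ⟨hn⟩
  exact exists_mulVec_eq_zero_iff.1 ⟨1, one_ne_zero, lapBar_mulVec_one A⟩

/-- The diagonal cofactors of a matrix are its principal minors. -/
theorem adjugate_apply_self_eq_det_submatrix {n : ℕ} (M : Matrix (Fin n) (Fin n) ℝ) (i : Fin n) :
    M.adjugate i i = (M.submatrix (fun k : {j : Fin n // j ≠ i} => (k : Fin n))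
      (fun k : {j : Fin n // j ≠ i} => (k : Fin n))).det := by
  rw [adjugate_apply, twoBlockTriangular_det _ (fun k => k ≠ i)]
  · have h1 : (toSquareBlockProp (M.updateRow i (Pi.single i 1)) fun k => ¬ k ≠ i).det = 1 := by
      have : Unique {a : Fin n // ¬ a ≠ i} :=
        ⟨⟨⟨i, by simp⟩⟩, fun a => Subtype.ext (not_not.1 a.2)⟩
      rw [det_unique]
      have h : ((default : {a : Fin n // ¬ a ≠ i}) : Fin n) = i := 
        not_not.1 (default : {a : Fin n // ¬ a ≠ i}).2
      simp [toSquareBlockProp_def, h]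
    rw [h1, mul_one]
    congr 1
    ext a b
    simp [toSquareBlockProp_def, updateRow_ne a.2]
  · rintro k hk l hl
    obtain rfl := not_not.1 hk
    simp [hl]

theorem StronglyConnected.minorDet_vecMul_lapBar {n : ℕ} {A : Matrix (Fin n) (Fin n) ℝ}
    (hsc : StronglyConnected A) : minorDet A ᵥ* lapBar A = 0 := by
  rcases Nat.eq_zero_or_pos n with rfl | hn
  · exact Subsingleton.elim _ _
  have hdet := det_lapBar hn.ne' A
  have hcol : ∀ i j, (lapBar A).adjugate i j = minorDet A j := by
    intro i j
    have h : lapBar A *ᵥ (fun k => (lapBar A).adjugate k j) = 0 := by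
      ext k
      have := congrFun (congrFun (mul_adjugate (lapBar A)) k) j
      simpa [hdet, mul_apply, mulVec, dotProduct] using this
    rw [hsc.eq_of_lapBar_mulVec_eq_zero h i j, minorDet, adjugate_apply_self_eq_det_submatrix]
  ext k
  have := congrFun (congrFun (adjugate_mul (lapBar A)) ⟨0, hn⟩) k
  simpa [hdet, mul_apply, hcol, vecMul, dotProduct] using this

theorem StronglyConnected.minorDet_pos {n : ℕ} {A : Matrix (Fin n) (Fin n) ℝ}
    (hsc : StronglyConnected A) (j : Fin n) : 0 < minorDet A j := by
  set B := (lapBar A).submatrix (fun k : {i : Fin n // i ≠ j} => (k : Fin n))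
    (fun k : {i : Fin n // i ≠ j} => (k : Fin n)) with hB
  set f : ℝ → ℝ := fun t => ((1 - t) • (1 : Matrix {i : Fin n // i ≠ j} {i : Fin n // i ≠ j} ℝ)
    + t • B).det with hf
  have hcont : Continuous f := by
    apply Continuous.matrix_det
    fun_prop
  have hne : ∀ t ∈ Set.Icc (0 : ℝ) 1, f t ≠ 0 := by
    intro t ht h0
    rcases ht.1.eq_or_lt with rfl | htpos
    · simp [hf] at h0
    obtain ⟨v, hv0, hv⟩ := exists_mulVec_eq_zero_iff.2 h0
    set u : Fin n → ℝ := fun k => if h : k ≠ j then v ⟨k, h⟩ else 0 with hu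
    have huj : u j = 0 := by simp [hu]
    have hrow : ∀ k, k ≠ j → (1 - t) * u k + t * (lapBar A *ᵥ u) k = 0 := by
      intro k hk
      have h := congrFun hv ⟨k, hk⟩
      have hsum : (lapBar A *ᵥ u) k = (B *ᵥ v) ⟨k, hk⟩ := by
        simp only [mulVec, dotProduct, hB, submatrix_apply]
        rw [← Fintype.sum_subtype_add_sum_subtype (fun i => i ≠ j) (fun i => lapBar A k i * u i)]
        have hz : ∑ i : {i // ¬ i ≠ j}, lapBar A k i * u i = 0 :=
          Finset.sum_eq_zero fun i _ => by rw [not_not.1 i.2, huj, mul_zero]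
        rw [hz, add_zero]
        exact Finset.sum_congr rfl fun i _ => by simp [hu, i.2]
      rw [hsum]
      simpa [add_mulVec, smul_mulVec, hu, hk] using h
    have hle : ∀ w : Fin n → ℝ, w j = 0 →
        (∀ k, k ≠ j → (1 - t) * w k + t * (lapBar A *ᵥ w) k = 0) → ∀ k, w k ≤ 0 := by
      intro w hwj hw k
      rw [← hwj]
      refine hsc.le_of_lapBar_mulVec_nonpos j w (fun i hi hji => ?_) k
      have h1 := hw i hi
      have h2 : 0 ≤ (1 - t) * w i := mul_nonneg (by linarith [ht.2]) (hwj ▸ hji)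
      by_contra! h3
      linarith [mul_pos htpos h3]
    refine hv0 (funext fun k => ?_)
    have hk : v k = u k := by simp [hu, k.2]
    rw [hk]
    refine le_antisymm (hle u huj hrow k) ?_
    have := hle (-u) (by simp [huj]) (fun i hi => by
      have := hrow i hi
      simp only [mulVec_neg, Pi.neg_apply]
      linarith) k
    simpa using this
  have h0 : f 0 = 1 := by simp [hf]
  have h1 : f 1 = minorDet A j := by simp [hf, minorDet, hB]
  rw [← h1]
  by_contra! h
  obtain ⟨t, ht, hft⟩ := intermediate_value_Icc' zero_le_one hcont.continuousOn
    (⟨h, by rw [h0]; exact zero_le_one⟩ : (0 : ℝ) ∈ Set.Icc (f 1) (f 0))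
  exact hne t ht hft

/-- Scalar comparison lemma for fixed-time convergence. -/
theorem eq_zero_of_hasDerivWithinAt_le_neg_rpow {E E' : ℝ → ℝ} {a b c₁ c₂ : ℝ}
    (ha : 1 < a) (hb : b < 1) (hc₁ : 0 < c₁) (hc₂ : 0 < c₂)
    (hE : ∀ t, 0 ≤ t → HasDerivWithinAt E (E' t) (Set.Ici 0) t)
    (hE0 : ∀ t, 0 ≤ t → 0 ≤ E t)
    (hE' : ∀ t, 0 ≤ t → E' t ≤ -2 * (c₁ * E t ^ ((1 + a) / 2) + c₂ * E t ^ ((1 + b) / 2)))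
    {t : ℝ} (ht : 1 / ((a - 1) * c₁) + 1 / ((1 - b) * c₂) ≤ t) : E t = 0 := by
  set t₁ := 1 / ((a - 1) * c₁) with ht₁
  set t₂ := 1 / ((1 - b) * c₂) with ht₂
  have hac : 0 < (a - 1) * c₁ := mul_pos (by linarith) hc₁
  have hbc : 0 < (1 - b) * c₂ := mul_pos (by linarith) hc₂
  have ht₁0 : 0 < t₁ := by positivity
  have ht₂0 : 0 < t₂ := by positivity
  have ht0 : 0 < t := by linarith
  by_contra hne
  have hinterior : interior (Set.Ici (0 : ℝ)) = Set.Ioi 0 := interior_Ici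
  have hEcont : ContinuousOn E (Set.Ici 0) := fun s hs => (hE s hs).continuousWithinAt
  have hEd : ∀ s, 0 < s → HasDerivAt E (E' s) s := fun s hs =>
    (hE s hs.le).hasDerivAt (Ici_mem_nhds hs)
  have hanti : AntitoneOn E (Set.Ici 0) := by
    refine antitoneOn_of_hasDerivWithinAt_nonpos (f' := E') (convex_Ici 0) hEcont ?_ ?_
    · intro s hs
      rw [hinterior] at hs
      exact (hEd s hs).hasDerivWithinAt
    · intro s hs
      rw [hinterior] at hs
      have h1 := Real.rpow_nonneg (hE0 s (le_of_lt hs)) ((1 + a) / 2)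
      have h2 := Real.rpow_nonneg (hE0 s (le_of_lt hs)) ((1 + b) / 2)
      have := hE' s (le_of_lt hs)
      nlinarith [mul_nonneg hc₁.le h1, mul_nonneg hc₂.le h2]
  have hpos : ∀ s ∈ Set.Icc 0 t, 0 < E s := fun s hs =>
    (lt_of_le_of_ne (hE0 t ht0.le) (Ne.symm hne)).trans_le (hanti hs.1 ht0.le hs.2)
  have hderiv : ∀ γ : ℝ, ∀ s ∈ Set.Ioo 0 t,
      HasDerivAt (fun s => E s ^ γ) (E' s * γ * E s ^ (γ - 1)) s := fun γ s hs =>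
    (hEd s hs.1).rpow_const (Or.inl (hpos s ⟨hs.1.le, hs.2.le⟩).ne')
  have hcont : ∀ γ : ℝ, ContinuousOn (fun s => E s ^ γ) (Set.Icc 0 t) := fun γ =>
    (hEcont.mono Set.Icc_subset_Ici_self).rpow_const fun s hs => Or.inl (hpos s hs).ne'
  have hmono : MonotoneOn (fun s => E s ^ ((1 - a) / 2) - (a - 1) * c₁ * s) (Set.Icc 0 t) := by
    refine monotoneOn_of_hasDerivWithinAt_nonneg (convex_Icc 0 t)
      (f' := fun s => E' s * ((1 - a) / 2) * E s ^ ((1 - a) / 2 - 1) - (a - 1) * c₁ * 1)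
      ((hcont _).sub (by fun_prop)) ?_ ?_
    · intro s hs
      rw [interior_Icc] at hs
      exact ((hderiv _ s hs).sub ((hasDerivAt_id' s).const_mul _)).hasDerivWithinAt
    · intro s hs
      rw [interior_Icc] at hs
      have hp := hpos s ⟨hs.1.le, hs.2.le⟩
      have h1 := hE' s hs.1.le
      have h2 : E s ^ ((1 + a) / 2) * E s ^ ((1 - a) / 2 - 1) = 1 := by
        rw [← Real.rpow_add hp]; ring_nf; exact Real.rpow_zero _
      have h3 := Real.rpow_pos_of_pos hp ((1 + b) / 2)
      have h4 := Real.rpow_pos_of_pos hp ((1 - a) / 2 - 1)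
      have h5 : E' s * E s ^ ((1 - a) / 2 - 1) ≤ -2 * c₁ := by
        have h6 : E' s ≤ -2 * (c₁ * E s ^ ((1 + a) / 2)) := by
          nlinarith [mul_pos hc₂ h3]
        calc _ ≤ -2 * (c₁ * E s ^ ((1 + a) / 2)) * E s ^ ((1 - a) / 2 - 1) := by gcongr
          _ = -2 * c₁ * (E s ^ ((1 + a) / 2) * E s ^ ((1 - a) / 2 - 1)) := by ring
          _ = _ := by rw [h2, mul_one]
      nlinarith
  have hanti' : AntitoneOn (fun s => E s ^ ((1 - b) / 2) + (1 - b) * c₂ * s) (Set.Icc 0 t) := by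
    refine antitoneOn_of_hasDerivWithinAt_nonpos (convex_Icc 0 t)
      (f' := fun s => E' s * ((1 - b) / 2) * E s ^ ((1 - b) / 2 - 1) + (1 - b) * c₂ * 1)
      ((hcont _).add (by fun_prop)) ?_ ?_
    · intro s hs
      rw [interior_Icc] at hs
      exact ((hderiv _ s hs).add ((hasDerivAt_id' s).const_mul _)).hasDerivWithinAt
    · intro s hs
      rw [interior_Icc] at hs
      have hp := hpos s ⟨hs.1.le, hs.2.le⟩
      have h1 := hE' s hs.1.le
      have h2 : E s ^ ((1 + b) / 2) * E s ^ ((1 - b) / 2 - 1) = 1 := by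
        rw [← Real.rpow_add hp]; ring_nf; exact Real.rpow_zero _
      have h3 := Real.rpow_pos_of_pos hp ((1 + a) / 2)
      have h4 := Real.rpow_pos_of_pos hp ((1 - b) / 2 - 1)
      have h5 : E' s * E s ^ ((1 - b) / 2 - 1) ≤ -2 * c₂ := by
        have h6 : E' s ≤ -2 * (c₂ * E s ^ ((1 + b) / 2)) := by
          nlinarith [mul_pos hc₁ h3]
        calc _ ≤ -2 * (c₂ * E s ^ ((1 + b) / 2)) * E s ^ ((1 - b) / 2 - 1) := by gcongr
          _ = -2 * c₂ * (E s ^ ((1 + b) / 2) * E s ^ ((1 - b) / 2 - 1)) := by ring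
          _ = _ := by rw [h2, mul_one]
      nlinarith
  have ht₁t : t₁ ∈ Set.Icc 0 t := ⟨ht₁0.le, by linarith⟩
  have hE₁ : E t₁ < 1 := by
    have h := hmono ⟨le_rfl, ht0.le⟩ ht₁t ht₁0.le
    simp only [mul_zero, sub_zero] at h
    rw [ht₁, mul_one_div_cancel hac.ne', ← ht₁] at h
    have h0 := Real.rpow_pos_of_pos (hpos 0 ⟨le_rfl, ht0.le⟩) ((1 - a) / 2)
    by_contra! h1
    linarith [Real.rpow_le_one_of_one_le_of_nonpos h1 (by linarith : (1 - a) / 2 ≤ 0)]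
  have h := hanti' ht₁t ⟨ht0.le, le_rfl⟩ ht₁t.2
  simp only at h
  have h2 : E t₁ ^ ((1 - b) / 2) < 1 :=
    Real.rpow_lt_one (hpos t₁ ht₁t).le hE₁ (by linarith)
  have h3 := Real.rpow_pos_of_pos (hpos t ⟨ht0.le, le_rfl⟩) ((1 - b) / 2)
  have h4 : 1 ≤ (1 - b) * c₂ * (t - t₁) := by
    calc 1 = (1 - b) * c₂ * t₂ := by rw [ht₂, mul_one_div_cancel hbc.ne']
      _ ≤ _ := by gcongr; linarith
  linarith [mul_sub ((1 - b) * c₂) t t₁]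

theorem Real.rpow_sum_le_sum_rpow_of_nonneg {ι : Type*} (s : Finset ι) {f : ι → ℝ} {p : ℝ}
    (hp0 : 0 < p) (hp1 : p ≤ 1) (hf : ∀ i ∈ s, 0 ≤ f i) :
    (∑ i ∈ s, f i) ^ p ≤ ∑ i ∈ s, f i ^ p :=
  Finset.le_sum_of_subadditive_on_pred (fun y : ℝ => y ^ p) (fun y => 0 ≤ y)
    (Real.zero_rpow hp0.ne').le
    (fun _ _ hx hy => Real.rpow_add_le_add_rpow hx hy hp0.le hp1)
    (fun _ _ hx hy => add_nonneg hx hy) f hf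

theorem IsGauge.mul_self {n : ℕ} {σ : Fin n → ℝ} (hσ : IsGauge σ) (i : Fin n) : σ i * σ i = 1 := by
  rcases hσ i with h | h <;> simp [h]

theorem IsGauge.apply_eq_mul_abs_mul {n : ℕ} {σ : Fin n → ℝ} (hσ : IsGauge σ)
    {A : Matrix (Fin n) (Fin n) ℝ} (hbal : ∀ i j, 0 ≤ σ i * A i j * σ j) (i j : Fin n) :
    A i j = σ i * |A i j| * σ j := by
  have h := hbal i j
  rcases hσ i with hi | hi <;> rcases hσ j with hj | hj <;> rw [hi, hj] at h ⊢ <;>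
    first
    | rw [abs_of_nonneg (by linarith)]; ring
    | rw [abs_of_nonpos (by linarith)]; ring

theorem IsGauge.lapOf_mulVec_apply {n : ℕ} {σ : Fin n → ℝ} (hσ : IsGauge σ)
    {A : Matrix (Fin n) (Fin n) ℝ} (hbal : ∀ i j, 0 ≤ σ i * A i j * σ j) (x : Fin n → ℝ)
    (i : Fin n) : (lapOf A *ᵥ x) i = σ i * (lapBar A *ᵥ fun k => σ k * x k) i := by
  rw [lapBar_mulVec_apply, lapOf, sub_mulVec, Pi.sub_apply, mulVec_diagonal, inDeg, mulVec,
    dotProduct, Finset.sum_mul, ← Finset.sum_sub_distrib, Finset.mul_sum]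
  refine Finset.sum_congr rfl fun l _ => ?_
  have h1 := hσ.apply_eq_mul_abs_mul hbal i l
  have h2 := hσ.mul_self i
  linear_combination (-x l) * h1 - |A i l| * x i * h2

theorem StronglyConnected.dotProduct_mirrorLap_mulVec {n : ℕ} {A : Matrix (Fin n) (Fin n) ℝ}
    (hsc : StronglyConnected A) {σ : Fin n → ℝ} (hσ : IsGauge σ)
    (hbal : ∀ i j, 0 ≤ σ i * A i j * σ j) (x : Fin n → ℝ) :
    x ⬝ᵥ mirrorLap A *ᵥ x =
      ∑ i, ∑ l, 1 / 2 * (minorDet A i * |A i l|) * (σ i * x i - σ l * x l) ^ 2 := by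
  set y : Fin n → ℝ := fun k => σ k * x k with hy
  have h1 : x ⬝ᵥ mirrorLap A *ᵥ x = x ⬝ᵥ (Wmat A * lapOf A) *ᵥ x := by
    have h : x ⬝ᵥ ((lapOf A)ᵀ * Wmat A) *ᵥ x = x ⬝ᵥ (Wmat A * lapOf A) *ᵥ x := by
      have hT : (lapOf A)ᵀ * Wmat A = (Wmat A * lapOf A)ᵀ := by
        rw [transpose_mul, Wmat, diagonal_transpose]
      rw [hT, mulVec_transpose, dotProduct_comm, dotProduct_mulVec]
    rw [mirrorLap, smul_mulVec, add_mulVec, dotProduct_smul, dotProduct_add, h, smul_eq_mul]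
    ring
  have h2 : x ⬝ᵥ (Wmat A * lapOf A) *ᵥ x =
      ∑ i, ∑ l, minorDet A i * |A i l| * (y i * (y i - y l)) := by
    rw [← mulVec_mulVec, Wmat, dotProduct]
    refine Finset.sum_congr rfl fun i _ => ?_
    rw [mulVec_diagonal, hσ.lapOf_mulVec_apply hbal, lapBar_mulVec_apply, Finset.mul_sum,
      Finset.mul_sum, Finset.mul_sum]
    refine Finset.sum_congr rfl fun l _ => ?_
    simp only [hy]
    ring
  have h3 : ∑ i, ∑ l, minorDet A i * |A i l| * (y i ^ 2 - y l ^ 2) = 0 := by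
    have h : minorDet A ⬝ᵥ lapBar A *ᵥ (fun k => y k ^ 2) = 0 := by
      rw [dotProduct_mulVec, hsc.minorDet_vecMul_lapBar, zero_dotProduct]
    rw [← h, dotProduct]
    refine Finset.sum_congr rfl fun i _ => ?_
    rw [lapBar_mulVec_apply, Finset.mul_sum]
    exact Finset.sum_congr rfl fun l _ => by ring
  rw [h1, h2, ← add_zero (∑ i, ∑ l, 1 / 2 * _ * _), ← mul_zero (1 / 2 : ℝ), ← h3, Finset.mul_sum,
    ← Finset.sum_add_distrib]
  refine Finset.sum_congr rfl fun i _ => ?_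
  rw [Finset.mul_sum, ← Finset.sum_add_distrib]
  exact Finset.sum_congr rfl fun l _ => by ring

theorem StronglyConnected.posSemidef_mirrorLap {n : ℕ} {A : Matrix (Fin n) (Fin n) ℝ}
    (hsc : StronglyConnected A) {σ : Fin n → ℝ} (hσ : IsGauge σ)
    (hbal : ∀ i j, 0 ≤ σ i * A i j * σ j) (hH : (mirrorLap A).IsHermitian) :
    (mirrorLap A).PosSemidef := by
  refine PosSemidef.of_dotProduct_mulVec_nonneg hH fun x => ?_
  rw [star_trivial, hsc.dotProduct_mirrorLap_mulVec hσ hbal]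
  exact Finset.sum_nonneg fun i _ => Finset.sum_nonneg fun l _ => by
    have := hsc.minorDet_pos i
    positivity

/-- The kernel of the mirror Laplacian is spanned by the gauge vector. -/
theorem StronglyConnected.mirrorLap_mulVec_eq_zero_iff {n : ℕ} {A : Matrix (Fin n) (Fin n) ℝ}
    (hsc : StronglyConnected A) {σ : Fin n → ℝ} (hσ : IsGauge σ)
    (hbal : ∀ i j, 0 ≤ σ i * A i j * σ j) (hH : (mirrorLap A).IsHermitian) (x : Fin n → ℝ) :
    mirrorLap A *ᵥ x = 0 ↔ ∃ c : ℝ, x = c • σ := by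
  have hquad := hsc.dotProduct_mirrorLap_mulVec hσ hbal x
  constructor
  · intro h
    rw [h, dotProduct_zero] at hquad
    have hnn : ∀ i l, 0 ≤ 1 / 2 * (minorDet A i * |A i l|) * (σ i * x i - σ l * x l) ^ 2 := by
      intro i l
      have := hsc.minorDet_pos i
      positivity
    have hterm : ∀ i l, 1 / 2 * (minorDet A i * |A i l|) * (σ i * x i - σ l * x l) ^ 2 = 0 := by
      intro i l
      have h1 := (Finset.sum_eq_zero_iff_of_nonneg fun i _ => Finset.sum_nonneg fun l _ => hnn i l).1
        hquad.symm i (Finset.mem_univ i)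
      exact (Finset.sum_eq_zero_iff_of_nonneg fun l _ => hnn i l).1 h1 l (Finset.mem_univ l)
    have hker : lapBar A *ᵥ (fun k => σ k * x k) = 0 := by
      ext i
      rw [lapBar_mulVec_apply]
      refine Finset.sum_eq_zero fun l _ => ?_
      have h1 := hterm i l
      have h2 := (hsc.minorDet_pos i).ne'
      simp only [mul_eq_zero, h2, pow_eq_zero_iff two_ne_zero, false_or] at h1 ⊢
      rcases h1 with (h1 | h1) | h1
      · norm_num at h1
      · exact Or.inl h1
      · exact Or.inr h1
    rcases Nat.eq_zero_or_pos n with rfl | hn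
    · exact ⟨0, Subsingleton.elim _ _⟩
    refine ⟨σ ⟨0, hn⟩ * x ⟨0, hn⟩, funext fun i => ?_⟩
    have h1 := hsc.eq_of_lapBar_mulVec_eq_zero hker i ⟨0, hn⟩
    rw [Pi.smul_apply, smul_eq_mul, ← h1]
    linear_combination (-x i) * hσ.mul_self i
  · rintro ⟨c, rfl⟩
    rw [← (hsc.posSemidef_mirrorLap hσ hbal hH).dotProduct_mulVec_zero_iff, star_trivial, hquad]
    refine Finset.sum_eq_zero fun i _ => Finset.sum_eq_zero fun l _ => ?_
    have h1 := hσ.mul_self i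
    have h2 := hσ.mul_self l
    simp only [Pi.smul_apply, smul_eq_mul]
    have : σ i * (c * σ i) - σ l * (c * σ l) = 0 := by linear_combination c * h1 - c * h2
    rw [this]
    ring

theorem Matrix.IsHermitian.dotProduct_mulVec_eq_sum_eigenvalues {n : ℕ}
    {M : Matrix (Fin n) (Fin n) ℝ} (hM : M.IsHermitian) (x : Fin n → ℝ) :
    x ⬝ᵥ M *ᵥ x = ∑ i, hM.eigenvalues i * (⇑(hM.eigenvectorBasis i) ⬝ᵥ x) ^ 2 ∧
      (M *ᵥ x) ⬝ᵥ (M *ᵥ x) =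
        ∑ i, hM.eigenvalues i ^ 2 * (⇑(hM.eigenvectorBasis i) ⬝ᵥ x) ^ 2 := by
  have hpars : ∀ y z : Fin n → ℝ, y ⬝ᵥ z =
      ∑ i, (⇑(hM.eigenvectorBasis i) ⬝ᵥ y) * (⇑(hM.eigenvectorBasis i) ⬝ᵥ z) := by
    intro y z
    have h := hM.eigenvectorBasis.sum_inner_mul_inner (WithLp.toLp 2 y) (WithLp.toLp 2 z)
    simp only [EuclideanSpace.inner_eq_star_dotProduct, star_trivial] at h
    rw [dotProduct_comm, ← h]
    exact Finset.sum_congr rfl fun i _ => by rw [dotProduct_comm z]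
  have hcoef : ∀ i, ⇑(hM.eigenvectorBasis i) ⬝ᵥ M *ᵥ x =
      hM.eigenvalues i * (⇑(hM.eigenvectorBasis i) ⬝ᵥ x) := by
    intro i
    have hT : Mᵀ = M := by simpa [conjTranspose_eq_transpose_of_trivial] using hM.eq
    rw [dotProduct_mulVec, ← mulVec_transpose, hT, hM.mulVec_eigenvectorBasis, smul_dotProduct,
      smul_eq_mul]
  constructor
  · rw [hpars]
    exact Finset.sum_congr rfl fun i _ => by rw [hcoef]; ring
  · rw [hpars]
    exact Finset.sum_congr rfl fun i _ => by rw [hcoef]; ring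

/-- Spectral gap of a positive semidefinite matrix whose kernel is a line. -/
theorem Matrix.PosSemidef.spectral_gap {n : ℕ} (hn : 2 ≤ n) {M : Matrix (Fin n) (Fin n) ℝ}
    (hM : M.PosSemidef) {σ : Fin n → ℝ} (hσ : σ ≠ 0)
    (hker : ∀ x, M *ᵥ x = 0 ↔ ∃ c : ℝ, x = c • σ)
    {lam : Fin n → ℝ} {e : Fin n ≃ Fin n} (hlam : lam = hM.isHermitian.eigenvalues ∘ e)
    (hmono : Monotone lam) :
    0 < lam ⟨1, by omega⟩ ∧
      ∀ x, lam ⟨1, by omega⟩ * (x ⬝ᵥ M *ᵥ x) ≤ (M *ᵥ x) ⬝ᵥ (M *ᵥ x) := by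
  set i₀ : Fin n := ⟨0, by omega⟩ with hi₀
  set i₁ : Fin n := ⟨1, by omega⟩ with hi₁
  have h01 : i₀ ≠ i₁ := by simp [hi₀, hi₁]
  have hnn : ∀ i, 0 ≤ lam i := fun i => by rw [hlam]; exact hM.eigenvalues_nonneg _
  have h0 : lam i₀ = 0 := by
    have hdet : M.det = 0 :=
      exists_mulVec_eq_zero_iff.1 ⟨σ, hσ, (hker σ).2 ⟨1, (one_smul _ _).symm⟩⟩
    rw [hM.isHermitian.det_eq_prod_eigenvalues, Finset.prod_eq_zero_iff] at hdet
    obtain ⟨i, -, hi⟩ := hdet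
    have h1 : lam (e.symm i) = 0 := by simpa [hlam] using hi
    exact le_antisymm (h1 ▸ hmono (by simp [hi₀, Fin.le_def])) (hnn _)
  constructor
  · refine lt_of_le_of_ne (hnn i₁) fun h1 => ?_
    have hk : ∀ i, lam i = 0 → ∃ c : ℝ, ⇑(hM.isHermitian.eigenvectorBasis (e i)) = c • σ := by
      intro i hi
      rw [← hker, hM.isHermitian.mulVec_eigenvectorBasis]
      have : hM.isHermitian.eigenvalues (e i) = 0 := by simpa [hlam] using hi
      rw [this, zero_smul]
    obtain ⟨c₀, hc₀⟩ := hk i₀ h0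
    obtain ⟨c₁, hc₁⟩ := hk i₁ h1.symm
    have horth := hM.isHermitian.eigenvectorBasis.orthonormal
    have hinner := horth.2 (fun h => h01 (e.injective h))
    have hs : σ ⬝ᵥ σ ≠ 0 := fun h => hσ (dotProduct_self_eq_zero.1 h)
    simp only [EuclideanSpace.inner_eq_star_dotProduct, star_trivial, hc₀, hc₁, smul_dotProduct,
      dotProduct_smul, smul_eq_mul, mul_eq_zero, hs, or_false] at hinner
    have hne : ∀ i, ⇑(hM.isHermitian.eigenvectorBasis (e i)) ≠ 0 := fun i h =>
      horth.ne_zero (e i) (by ext k; exact congrFun h k)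
    rcases hinner with h | h
    · exact hne i₀ (by rw [hc₀, h, zero_smul])
    · exact hne i₁ (by rw [hc₁, h, zero_smul])
  · intro x
    obtain ⟨h1, h2⟩ := hM.isHermitian.dotProduct_mulVec_eq_sum_eigenvalues x
    rw [h1, h2, Finset.mul_sum]
    refine Finset.sum_le_sum fun i _ => ?_
    rw [← mul_assoc]
    refine mul_le_mul_of_nonneg_right ?_ (sq_nonneg _)
    have hi : hM.isHermitian.eigenvalues i = lam (e.symm i) := by simp [hlam]
    rw [hi]
    by_cases h : e.symm i = i₀
    · simp [h, h0]
    · have : i₁ ≤ e.symm i := by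
        rw [Fin.le_def]
        have : (e.symm i : ℕ) ≠ 0 := fun h' => h (Fin.ext h')
        change 1 ≤ (e.symm i : ℕ)
        omega
      nlinarith [hmono this, hnn (e.symm i)]

theorem Real.mul_sign_mul_abs_rpow (y : ℝ) {a : ℝ} (ha : 0 < a) :
    y * (Real.sign y * |y| ^ a) = (y ^ 2) ^ ((1 + a) / 2) := by
  rw [← sq_abs, ← Real.rpow_natCast, ← Real.rpow_mul (abs_nonneg y)]
  have h : ((2 : ℕ) : ℝ) * ((1 + a) / 2) = 1 + a := by push_cast; ring
  rw [h, Real.rpow_add_of_nonneg (abs_nonneg y) zero_le_one ha.le, Real.rpow_one, ← mul_assoc]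
  congr 1
  rcases lt_trichotomy y 0 with hy | rfl | hy
  · rw [Real.sign_of_neg hy, abs_of_neg hy]; ring
  · simp
  · rw [Real.sign_of_pos hy, abs_of_pos hy]; ring

theorem hasDerivWithinAt_dotProduct_mulVec {n : ℕ} {M : Matrix (Fin n) (Fin n) ℝ}
    (hM : M.IsHermitian) {x : ℝ → Fin n → ℝ} {x' : Fin n → ℝ} {S : Set ℝ} {t : ℝ}
    (hx : ∀ i, HasDerivWithinAt (fun s => x s i) (x' i) S t) :
    HasDerivWithinAt (fun s => x s ⬝ᵥ M *ᵥ x s) (2 * ((M *ᵥ x t) ⬝ᵥ x')) S t := by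
  have hT : Mᵀ = M := by simpa [conjTranspose_eq_transpose_of_trivial] using hM.eq
  have hMx : ∀ i, HasDerivWithinAt (fun s => (M *ᵥ x s) i) ((M *ᵥ x') i) S t := by
    intro i
    simp only [mulVec, dotProduct]
    exact HasDerivWithinAt.fun_sum fun j _ => (hx j).const_mul (M i j)
  have h1 : HasDerivWithinAt (fun s => x s ⬝ᵥ M *ᵥ x s)
      (∑ i, (x' i * (M *ᵥ x t) i + x t i * (M *ᵥ x') i)) S t :=
    HasDerivWithinAt.fun_sum fun i _ => (hx i).mul (hMx i)
  convert! h1 using 1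
  have h2 : x t ⬝ᵥ M *ᵥ x' = (M *ᵥ x t) ⬝ᵥ x' := by
    rw [dotProduct_mulVec, ← mulVec_transpose, hT]
  rw [Finset.sum_add_distrib]
  change _ = x' ⬝ᵥ M *ᵥ x t + x t ⬝ᵥ M *ᵥ x'
  rw [h2, dotProduct_comm x']
  ring

/-- Fixed-time convergence of the nonlinear protocol to the kernel of `M`. -/
theorem Matrix.PosSemidef.mulVec_eq_zero_of_protocol {n : ℕ} (hn : (0 : ℝ) < n)
    {M : Matrix (Fin n) (Fin n) ℝ} (hM : M.PosSemidef) {μ : ℝ} (hμ : 0 < μ)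
    (hgap : ∀ x, μ * (x ⬝ᵥ M *ᵥ x) ≤ (M *ᵥ x) ⬝ᵥ (M *ᵥ x))
    {k₁ k₂ a b : ℝ} (hk₁ : 0 < k₁) (hk₂ : 0 < k₂) (ha : 1 < a) (hb0 : 0 < b) (hb : b < 1)
    {x : ℝ → Fin n → ℝ}
    (hx : ∀ t : ℝ, 0 ≤ t → ∀ i : Fin n,
      HasDerivWithinAt (fun s => x s i)
        (k₁ * (Real.sign (-((M *ᵥ x t) i)) * |(-((M *ᵥ x t) i))| ^ a) +
         k₂ * (Real.sign (-((M *ᵥ x t) i)) * |(-((M *ᵥ x t) i))| ^ b))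
        (Set.Ici (0 : ℝ)) t)
    {t : ℝ} (ht : 1 / ((a - 1) * (μ * (k₁ * (n : ℝ) ^ ((1 - a) / 2)))) +
      1 / ((1 - b) * (μ * k₂)) ≤ t) :
    M *ᵥ x t = 0 := by
  have hnn : ∀ y, 0 ≤ y ⬝ᵥ M *ᵥ y := fun y => by
    simpa using hM.dotProduct_mulVec_nonneg y
  have hnpow := Real.rpow_pos_of_pos hn ((1 - a) / 2)
  have key := eq_zero_of_hasDerivWithinAt_le_neg_rpow (E := fun s => μ * (x s ⬝ᵥ M *ᵥ x s)) ha hb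
    (by positivity) (by positivity)
    (fun s hs => (hasDerivWithinAt_dotProduct_mulVec hM.isHermitian (hx s hs)).const_mul μ)
    (fun s _ => mul_nonneg hμ.le (hnn _)) ?_ ht
  · rw [← hM.dotProduct_mulVec_zero_iff, star_trivial]
    exact (mul_eq_zero.1 key).resolve_left hμ.ne'
  intro s _
  set y := M *ᵥ x s with hy
  have hE0 : 0 ≤ μ * (x s ⬝ᵥ y) := mul_nonneg hμ.le (hnn _)
  have hES : μ * (x s ⬝ᵥ y) ≤ ∑ i, y i ^ 2 := by
    simpa only [dotProduct, ← sq] using hgap (x s)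
  have hdot : (y ⬝ᵥ fun i => k₁ * (Real.sign (-(y i)) * |(-(y i))| ^ a) +
      k₂ * (Real.sign (-(y i)) * |(-(y i))| ^ b)) =
      -(k₁ * ∑ i, (y i ^ 2) ^ ((1 + a) / 2) + k₂ * ∑ i, (y i ^ 2) ^ ((1 + b) / 2)) := by
    rw [dotProduct, Finset.mul_sum, Finset.mul_sum, ← Finset.sum_add_distrib,
      ← Finset.sum_neg_distrib]
    refine Finset.sum_congr rfl fun i _ => ?_
    have h1 := Real.mul_sign_mul_abs_rpow (-(y i)) (by linarith : 0 < a)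
    have h2 := Real.mul_sign_mul_abs_rpow (-(y i)) hb0
    rw [neg_sq] at h1 h2
    linear_combination -k₁ * h1 - k₂ * h2
  have hA : (n : ℝ) ^ ((1 - a) / 2) * (μ * (x s ⬝ᵥ y)) ^ ((1 + a) / 2) ≤
      ∑ i, (y i ^ 2) ^ ((1 + a) / 2) := by
    have h := Real.rpow_sum_le_const_mul_sum_rpow_of_nonneg (s := Finset.univ)
      (f := fun i => y i ^ 2) (p := (1 + a) / 2) (by linarith) fun i _ => sq_nonneg _
    rw [Finset.card_univ, Fintype.card_fin] at h
    calc _ ≤ (n : ℝ) ^ ((1 - a) / 2) * (∑ i, y i ^ 2) ^ ((1 + a) / 2) := by gcongr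
      _ ≤ (n : ℝ) ^ ((1 - a) / 2) *
          ((n : ℝ) ^ ((1 + a) / 2 - 1) * ∑ i, (y i ^ 2) ^ ((1 + a) / 2)) := by gcongr
      _ = _ := by
        rw [← mul_assoc, ← Real.rpow_add hn]
        have : (1 - a) / 2 + ((1 + a) / 2 - 1) = 0 := by ring
        rw [this, Real.rpow_zero, one_mul]
  have hB : (μ * (x s ⬝ᵥ y)) ^ ((1 + b) / 2) ≤ ∑ i, (y i ^ 2) ^ ((1 + b) / 2) :=
    (Real.rpow_le_rpow hE0 hES (by linarith)).trans
      (Real.rpow_sum_le_sum_rpow_of_nonneg _ (by linarith) (by linarith) fun i _ => sq_nonneg _)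
  rw [hdot]
  have h1 := mul_le_mul_of_nonneg_left hA (mul_pos hμ hk₁).le
  have h2 := mul_le_mul_of_nonneg_left hB (mul_pos hμ hk₂).le
  linarith

/-- fixed-time bipartite consensus under the nonlinear protocol, on a
strongly connected structurally balanced signed digraph, with setting time at most
`T = (1/λ₂(L̂))·( n^{(m−r)/(2r)}·r/(k₁(m−r)) + q/(k₂(q−p)) )`. -/
theorem fixed_time_bipartite_consensus (n : ℕ) (hn : 2 ≤ n)
    (A : Matrix (Fin n) (Fin n) ℝ)
    (hdiag : ∀ i, A i i = 0) (hdigon : ∀ i j, 0 ≤ A i j * A j i)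
    (hsc : StronglyConnected A)
    (σ : Fin n → ℝ) (hσ : IsGauge σ) (hbal : ∀ i j, 0 ≤ σ i * A i j * σ j)
    (hH : (mirrorLap A).IsHermitian)
    (lam : Fin n → ℝ) (hlam : ∃ e : Fin n ≃ Fin n, lam = hH.eigenvalues ∘ e)
    (hmono : Monotone lam)
    (k₁ k₂ : ℝ) (hk₁ : 0 < k₁) (hk₂ : 0 < k₂)
    (m r p q : ℕ) (hmodd : Odd m) (hrodd : Odd r) (hpodd : Odd p) (hqodd : Odd q)
    (hm0 : 0 < m) (hr0 : 0 < r) (hp0 : 0 < p) (hq0 : 0 < q)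
    (hmr : r < m) (hpq : p < q)
    (x : ℝ → Fin n → ℝ)
    (hx : ∀ t : ℝ, 0 ≤ t → ∀ i : Fin n,
      HasDerivWithinAt (fun s => x s i)
        (k₁ * (Real.sign (-((mirrorLap A *ᵥ x t) i)) *
            |(-((mirrorLap A *ᵥ x t) i))| ^ ((m : ℝ) / r)) +
         k₂ * (Real.sign (-((mirrorLap A *ᵥ x t) i)) *
            |(-((mirrorLap A *ᵥ x t) i))| ^ ((p : ℝ) / q)))
        (Set.Ici (0 : ℝ)) t)
    (T : ℝ)
    (hT : T = (1 / lam ⟨1, by omega⟩) *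
      ((n : ℝ) ^ (((m : ℝ) - r) / (2 * r)) * r / (k₁ * ((m : ℝ) - r)) +
        q / (k₂ * ((q : ℝ) - p)))) :
    ∃ c : ℝ, ∀ t : ℝ, T ≤ t → x t = fun i => c * σ i := by
  obtain ⟨e, hlam⟩ := hlam
  have hpsd := hsc.posSemidef_mirrorLap hσ hbal hH
  have hker := hsc.mirrorLap_mulVec_eq_zero_iff hσ hbal hH
  have hσ0 : σ ≠ 0 := fun h => by simpa [h] using hσ.mul_self ⟨0, by omega⟩
  obtain ⟨hpos, hgap⟩ := hpsd.spectral_gap hn hσ0 hker hlam hmono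
  set μ := lam ⟨1, by omega⟩
  have hn0 : (0 : ℝ) < n := by exact_mod_cast (by omega : 0 < n)
  have hr : (0 : ℝ) < r := by exact_mod_cast hr0
  have hp : (0 : ℝ) < p := by exact_mod_cast hp0
  have hq : (0 : ℝ) < q := by exact_mod_cast hq0
  have hmr' : (0 : ℝ) < m - r := by rw [sub_pos]; exact_mod_cast hmr
  have hpq' : (0 : ℝ) < q - p := by rw [sub_pos]; exact_mod_cast hpq
  have hTeq : 1 / (((m : ℝ) / r - 1) * (μ * (k₁ * (n : ℝ) ^ ((1 - (m : ℝ) / r) / 2)))) +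
      1 / ((1 - (p : ℝ) / q) * (μ * k₂)) = T := by
    have h1 : ((1 - (m : ℝ) / r) / 2) = -(((m : ℝ) - r) / (2 * r)) := by field_simp; ring
    have h2 : (m : ℝ) / r - 1 = (m - r) / r := by field_simp
    have h3 : 1 - (p : ℝ) / q = (q - p) / q := by field_simp
    rw [hT, h1, h2, h3, Real.rpow_neg hn0.le]
    have := Real.rpow_pos_of_pos hn0 (((m : ℝ) - r) / (2 * r))
    field_simp
  have hT0 : 0 ≤ T := by rw [hT]; positivity
  have hzero : ∀ t, T ≤ t → mirrorLap A *ᵥ x t = 0 := fun t ht =>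
    hpsd.mulVec_eq_zero_of_protocol hn0 hpos hgap hk₁ hk₂
      (by rw [lt_div_iff₀ hr]; linarith) (by positivity) (by rw [div_lt_one hq]; linarith) hx
      (hTeq.trans_le ht)
  obtain ⟨c, hc⟩ := (hker _).1 (hzero T le_rfl)
  refine ⟨c, fun t ht => funext fun i => ?_⟩
  have hconst : x t i = x T i := by
    refine constant_of_has_deriv_right_zero (f := fun s => x s i) (b := t) ?_ ?_ t ⟨ht, le_rfl⟩
    · exact fun s hs => ((hx s (hT0.trans hs.1) i).continuousWithinAt).mono
        fun u hu => hT0.trans hu.1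
    · intro s hs
      have h := hx s (hT0.trans hs.1) i
      rw [hzero s hs.1] at h
      simp only [Pi.zero_apply, neg_zero, Real.sign_zero, zero_mul, mul_zero, add_zero] at h
      exact h.mono (Set.Ici_subset_Ici.2 (hT0.trans hs.1))
  rw [hconst, hc, Pi.smul_apply, smul_eq_mul]
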